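/- arXiv:2104.09939 — 2 statements merged into one kernel-verified Lean document; each statement's English description precedes it below -/
import Mathlib

section
/- Let K be the middle-third Cantor set and R = K ∩ [2/3,1]. For the fast subdivision (D_n) of [2/3,1], for every n ≥ 0: 0 ≤ L(P(D_n × D_n)) − L(P(R × R)) ≤ (1/63)·(1/36)^n, where P(x,y) = xy and L is Lebesgue measure. -/
open Set MeasureTheory

noncomputable def cantorK : Set ℝ :=
  {x | ∃ α : ℕ → ℝ, (∀ k, α k = 0 ∨ α k = 2) ∧ x = ∑' k : ℕ, α k / 3 ^ (k + 1)}

def Pset (E F : Set ℝ) : Set ℝ := Set.image2 (· * ·) E F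

/-- Orientation-preserving affine bijection from `[0,1]` onto the interval `I`. -/
noncomputable def affI (I : Set ℝ) (x : ℝ) : ℝ := sInf I + (sSup I - sInf I) * x

/-- The family of connected components of `S` with nonempty interior. -/
def compsE (S : Set ℝ) : Set (Set ℝ) :=
  {I | (∃ x ∈ S, I = connectedComponentIn S x) ∧ (interior I).Nonempty}

/-- The union `B` of gaps removed from `[0,1]` in the fast subdivision. -/
noncomputable def gapB : Set ℝ :=
  (⋃ k : ℕ, Ioo ((1:ℝ)/3^(k+2)) (2/3^(k+2))) ∪ Ioo (1/3) (2/3) ∪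
  ⋃ k : ℕ, Ioo (((3:ℝ)^(k+2) - 2)/3^(k+2)) ((3^(k+2) - 1)/3^(k+2))

/-- The fast subdivision of `[2/3, 1]`. -/
noncomputable def fastD : ℕ → Set ℝ
  | 0 => Icc (2/3) 1
  | n + 1 => fastD n \ ⋃ I ∈ compsE (fastD n), affI I '' gapB

namespace CantorProduct

/-- The length of the Cantor intervals of level `p` below `[2/3, 1]`. -/
noncomputable def len (p : ℕ) : ℝ := 1 / 3 ^ (p + 1)

/-- The left endpoints of the Cantor intervals of level `p` below `[2/3, 1]`. -/
def nodes : ℕ → Set ℝ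
  | 0 => {2 / 3}
  | p + 1 => {b | ∃ a ∈ nodes p, b = a ∨ b = a + 2 * len (p + 1)}

/-- The `p`-th stage of the middle-third construction inside `[2/3, 1]`. -/
def stage (p : ℕ) : Set ℝ := ⋃ a ∈ nodes p, Icc a (a + len p)

/-- The part of the Cantor set in `[2/3, 1]`, as the intersection of all stages. -/
def core : Set ℝ := ⋂ p, stage p

lemma len_pos (p : ℕ) : 0 < len p := by unfold len; positivity

lemma len_succ (p : ℕ) : len p = 3 * len (p + 1) := by
  unfold len; field_simp; ring

lemma len_add (p k : ℕ) : len (p + k) = len p / 3 ^ k := by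
  unfold len; field_simp; ring

lemma len_zero : len 0 = 1 / 3 := by norm_num [len]

lemma mem_stage {p : ℕ} {x : ℝ} : x ∈ stage p ↔ ∃ a ∈ nodes p, a ≤ x ∧ x ≤ a + len p := by
  simp only [stage, mem_iUnion, mem_Icc, exists_prop]

lemma mem_core {x : ℝ} : x ∈ core ↔ ∀ p, x ∈ stage p := by simp [core]

lemma nodes_even (p : ℕ) : ∀ a ∈ nodes p, ∃ m : ℤ, a = 2 * m * len p := by
  induction p with
  | zero =>
    rintro a rfl
    exact ⟨1, by norm_num [len]⟩
  | succ p ih =>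
    rintro b ⟨a, ha, rfl | rfl⟩
    · obtain ⟨m, rfl⟩ := ih _ ha
      exact ⟨3 * m, by push_cast; rw [len_succ p]; ring⟩
    · obtain ⟨m, rfl⟩ := ih _ ha
      exact ⟨3 * m + 1, by push_cast; rw [len_succ p]; ring⟩

lemma nodes_separated {p : ℕ} {a b : ℝ} (ha : a ∈ nodes p) (hb : b ∈ nodes p) (h : a < b) :
    a + 2 * len p ≤ b := by
  obtain ⟨m, rfl⟩ := nodes_even p a ha
  obtain ⟨k, rfl⟩ := nodes_even p b hb
  have hp := len_pos p
  have h1 : (m : ℝ) < k := by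
    by_contra! hc
    nlinarith
  have h2 : (m : ℝ) + 1 ≤ k := by exact_mod_cast h1
  nlinarith

lemma nodes_eq_of_close {p : ℕ} {a b : ℝ} (ha : a ∈ nodes p) (hb : b ∈ nodes p)
    (h1 : a < b + 2 * len p) (h2 : b < a + 2 * len p) : a = b := by
  rcases lt_trichotomy a b with h | h | h
  · linarith [nodes_separated ha hb h]
  · exact h
  · linarith [nodes_separated hb ha h]

lemma nodes_bounds (p : ℕ) : ∀ a ∈ nodes p, 2 / 3 ≤ a ∧ a + len p ≤ 1 := by
  induction p with
  | zero =>
    rintro a rfl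
    norm_num [len]
  | succ p ih =>
    have := len_pos (p + 1)
    have := len_succ p
    rintro b ⟨a, ha, rfl | rfl⟩ <;> obtain ⟨h1, h2⟩ := ih _ ha <;> constructor <;> linarith

lemma nodes_finite (p : ℕ) : (nodes p).Finite := by
  induction p with
  | zero => exact finite_singleton _
  | succ p ih =>
    refine (ih.union (ih.image fun a => a + 2 * len (p + 1))).subset ?_
    rintro b ⟨a, ha, rfl | rfl⟩
    · exact Or.inl ha
    · exact Or.inr ⟨a, ha, rfl⟩

lemma isCompact_stage (p : ℕ) : IsCompact (stage p) :=
  (nodes_finite p).isCompact_biUnion fun _ _ => isCompact_Icc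

lemma left_mem_nodes {p : ℕ} {a : ℝ} (ha : a ∈ nodes p) : a ∈ nodes (p + 1) :=
  ⟨a, ha, Or.inl rfl⟩

lemma right_mem_nodes {p : ℕ} {a : ℝ} (ha : a ∈ nodes p) : a + 2 * len (p + 1) ∈ nodes (p + 1) :=
  ⟨a, ha, Or.inr rfl⟩

lemma left_mem_nodes_add {p : ℕ} {a : ℝ} (ha : a ∈ nodes p) (k : ℕ) : a ∈ nodes (p + k) := by
  induction k with
  | zero => exact ha
  | succ k ih => exact left_mem_nodes ih

lemma right_mem_nodes_add {p : ℕ} {a : ℝ} (ha : a ∈ nodes p) (k : ℕ) :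
    a + len p - len (p + k) ∈ nodes (p + k) := by
  induction k with
  | zero => simpa using ha
  | succ k ih =>
    have h : a + len p - len (p + k) + 2 * len (p + k + 1) = a + len p - len (p + k + 1) := by
      rw [len_succ (p + k)]
      ring
    exact h ▸ right_mem_nodes ih

lemma exists_ancestor {p : ℕ} (k : ℕ) : ∀ b ∈ nodes (p + k),
    ∃ a ∈ nodes p, a ≤ b ∧ b + len (p + k) ≤ a + len p := by
  induction k with
  | zero => exact fun b hb => ⟨b, hb, le_rfl, le_rfl⟩
  | succ k ih =>
    have h1 := len_pos (p + k + 1)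
    have h2 := len_succ (p + k)
    rintro b ⟨c, hc, h⟩
    obtain ⟨a, ha, h3, h4⟩ := ih c hc
    change b = c ∨ b = c + 2 * len (p + k + 1) at h
    change ∃ a ∈ nodes p, a ≤ b ∧ b + len (p + k + 1) ≤ a + len p
    refine ⟨a, ha, ?_, ?_⟩ <;> rcases h with rfl | rfl <;> linarith

lemma exists_ancestor_of_le {p q : ℕ} (h : p ≤ q) {b : ℝ} (hb : b ∈ nodes q) :
    ∃ a ∈ nodes p, a ≤ b ∧ b + len q ≤ a + len p := by
  obtain ⟨k, rfl⟩ := Nat.exists_eq_add_of_le h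
  exact exists_ancestor k b hb

lemma stage_antitone {p q : ℕ} (h : p ≤ q) : stage q ⊆ stage p := by
  intro x hx
  obtain ⟨b, hb, h1, h2⟩ := mem_stage.1 hx
  obtain ⟨a, ha, h3, h4⟩ := exists_ancestor_of_le h hb
  exact mem_stage.2 ⟨a, ha, by linarith, by linarith⟩

lemma mem_core_of_forall_add {p : ℕ} {x : ℝ} (h : ∀ k, x ∈ stage (p + k)) : x ∈ core :=
  mem_core.2 fun q => stage_antitone (Nat.le_add_left q p) (h q)

lemma left_mem_core {p : ℕ} {a : ℝ} (ha : a ∈ nodes p) : a ∈ core :=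
  mem_core_of_forall_add fun k => mem_stage.2
    ⟨a, left_mem_nodes_add ha k, le_rfl, by linarith [len_pos (p + k)]⟩

lemma right_mem_core {p : ℕ} {a : ℝ} (ha : a ∈ nodes p) : a + len p ∈ core :=
  mem_core_of_forall_add fun k => mem_stage.2
    ⟨_, right_mem_nodes_add ha k, by linarith [len_pos (p + k)], by linarith⟩

lemma middle_third_notMem_stage {p : ℕ} {a x : ℝ} (ha : a ∈ nodes p)
    (h1 : a + len (p + 1) < x) (h2 : x < a + 2 * len (p + 1)) : x ∉ stage (p + 1) := by
  intro hx
  have hl := len_pos (p + 1)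
  obtain ⟨b, hb, h3, h4⟩ := mem_stage.1 hx
  have := nodes_eq_of_close (left_mem_nodes ha) hb (by linarith) (by linarith)
  linarith

lemma mem_interval_of_mem_stage {p : ℕ} {a x : ℝ} (ha : a ∈ nodes p) (hx : x ∈ stage p)
    (h1 : a - len p < x) (h2 : x < a + 2 * len p) : a ≤ x ∧ x ≤ a + len p := by
  obtain ⟨b, hb, h3, h4⟩ := mem_stage.1 hx
  have := nodes_eq_of_close ha hb (by linarith) (by linarith)
  subst this
  exact ⟨h3, h4⟩

lemma tendsto_len : Filter.Tendsto len Filter.atTop (nhds 0) := by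
  have h := tendsto_pow_atTop_nhds_zero_of_lt_one (r := (1 / 3 : ℝ)) (by norm_num) (by norm_num)
  have h2 := h.comp (Filter.tendsto_add_atTop_nat 1)
  refine h2.congr fun p => ?_
  simp [len]

lemma summable_digits {α : ℕ → ℝ} (h : ∀ k, α k = 0 ∨ α k = 2) :
    Summable fun k => α k / 3 ^ (k + 1) := by
  have hg : Summable fun k : ℕ => 2 / 3 * (1 / 3 : ℝ) ^ k :=
    (summable_geometric_of_lt_one (by norm_num) (by norm_num)).mul_left _
  refine Summable.of_nonneg_of_le (fun k => ?_) (fun k => ?_) hg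
  · rcases h k with h | h <;> rw [h] <;> positivity
  · rw [one_div, inv_pow, pow_succ]
    rcases h k with h | h <;> rw [h]
    · simp
    · field_simp; norm_num

lemma tsum_digits_bounds {α : ℕ → ℝ} (h : ∀ k, α k = 0 ∨ α k = 2) :
    0 ≤ ∑' k, α k / 3 ^ (k + 1) ∧ ∑' k, α k / 3 ^ (k + 1) ≤ 1 := by
  constructor
  · refine tsum_nonneg fun k => ?_
    rcases h k with h | h <;> rw [h] <;> positivity
  · have hg : HasSum (fun k : ℕ => 2 / 3 * (1 / 3 : ℝ) ^ k) 1 := by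
      have hg := (hasSum_geometric_of_lt_one (r := (1 / 3 : ℝ)) (by norm_num)
        (by norm_num)).mul_left (2 / 3)
      rwa [show (2 / 3 : ℝ) * (1 - 1 / 3)⁻¹ = 1 by norm_num] at hg
    refine hasSum_le (fun k => ?_) (summable_digits h).hasSum hg
    rw [one_div, inv_pow, pow_succ]
    rcases h k with h | h <;> rw [h]
    · simp
    · field_simp; norm_num

lemma tsum_digits_sub {α : ℕ → ℝ} (h : ∀ k, α k = 0 ∨ α k = 2) (n : ℕ) :
    ∑ k ∈ Finset.range (n + 1), α k / 3 ^ (k + 1) ≤ ∑' k, α k / 3 ^ (k + 1) ∧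
    ∑' k, α k / 3 ^ (k + 1) ≤ ∑ k ∈ Finset.range (n + 1), α k / 3 ^ (k + 1) + len n := by
  have hs := (summable_digits h).sum_add_tsum_nat_add (n + 1)
  have ht : ∑' k, α (k + (n + 1)) / 3 ^ (k + (n + 1) + 1)
      = len n * ∑' k, α (k + (n + 1)) / 3 ^ (k + 1) := by
    rw [← tsum_mul_left]
    refine tsum_congr fun k => ?_
    rw [len]; field_simp; ring
  obtain ⟨h0, h1⟩ := tsum_digits_bounds fun k => h (k + (n + 1))
  have hl := len_pos n
  constructor <;> nlinarith

lemma cantorK_inter_eq_core : cantorK ∩ Icc (2 / 3) 1 = core := by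
  ext x
  constructor
  · rintro ⟨⟨α, hα, rfl⟩, hx, -⟩
    refine mem_core.2 fun p => mem_stage.2 ⟨_, ?_, tsum_digits_sub hα p⟩
    induction p with
    | zero =>
      have h0 := (tsum_digits_sub hα 0).2
      rcases hα 0 with h | h
      · rw [Finset.sum_range_one, h, len_zero] at h0
        norm_num at h0
        linarith
      · simp [nodes, h]
    | succ p ih =>
      refine ⟨_, ih, ?_⟩
      rw [Finset.sum_range_succ _ (p + 1)]
      rcases hα (p + 1) with h | h <;> rw [h]
      · simp
      · right; rw [len]; ring
  · intro hx
    have hx' := mem_core.1 hx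
    choose a ha h1 h2 using fun p => mem_stage.1 (hx' p)
    have h3 := h1 0
    have h4 := h2 0
    have ha0 : a 0 = 2 / 3 := ha 0
    rw [len_zero] at h4
    refine ⟨?_, by linarith, by linarith⟩
    have hstep : ∀ p, a (p + 1) = a p ∨ a (p + 1) = a p + 2 * len (p + 1) := by
      intro p
      obtain ⟨c, hc, h⟩ := ha (p + 1)
      have e1 := len_pos (p + 1)
      have e2 := len_succ p
      have := h1 p
      have := h2 p
      have := h1 (p + 1)
      have := h2 (p + 1)
      have : a p = c := nodes_eq_of_close (ha p) hc (by rcases h with h | h <;> linarith)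
        (by rcases h with h | h <;> linarith)
      rwa [this]
    let α : ℕ → ℝ := fun k => if k = 0 then 2 else (a k - a (k - 1)) * 3 ^ (k + 1)
    have hα : ∀ k, α k = 0 ∨ α k = 2 := by
      rintro (_ | k)
      · simp [α]
      · rcases hstep k with h | h
        · simp [α, h]
        · right
          simp only [α, h, len, Nat.add_sub_cancel]
          rw [if_neg (Nat.succ_ne_zero k)]
          field_simp
          ring
    have hsum : ∀ p, ∑ k ∈ Finset.range (p + 1), α k / 3 ^ (k + 1) = a p := by
      intro p
      induction p with
      | zero => simp [α, ha0]
      | succ p ih =>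
        rw [Finset.sum_range_succ, ih]
        simp [α]
    refine ⟨α, hα, ?_⟩
    refine tendsto_nhds_unique (f := a) (l := Filter.atTop) ?_ ?_
    · refine tendsto_order.2 ⟨fun y hy => ?_, fun y hy => ?_⟩
      · filter_upwards [(tendsto_order.1 tendsto_len).2 (x - y) (by linarith)] with p hp
        linarith [h2 p]
      · exact Filter.Eventually.of_forall fun p => (h1 p).trans_lt hy
    · have := ((summable_digits hα).hasSum.tendsto_sum_nat).comp (Filter.tendsto_add_atTop_nat 1)
      exact this.congr hsum

lemma mul_mem_Pset_Icc {a b c d z : ℝ} (ha : 0 < a) (hab : a ≤ b) (hc : 0 < c) (hcd : c ≤ d)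
    (h1 : a * c ≤ z) (h2 : z ≤ b * d) : z ∈ Pset (Icc a b) (Icc c d) := by
  have hb : 0 < b := ha.trans_le hab
  rcases le_total z (b * c) with h | h
  · exact ⟨z / c, ⟨(le_div_iff₀ hc).2 h1, (div_le_iff₀ hc).2 h⟩, c, ⟨le_rfl, hcd⟩,
      div_mul_cancel₀ z hc.ne'⟩
  · exact ⟨b, ⟨hab, le_rfl⟩, z / b, ⟨(le_div_iff₀ hb).2 (by linarith),
      (div_le_iff₀ hb).2 (by linarith)⟩, mul_div_cancel₀ z hb.ne'⟩

lemma Pset_Icc_bounds {a b c d z : ℝ} (ha : 0 < a) (hc : 0 < c)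
    (h : z ∈ Pset (Icc a b) (Icc c d)) : a * c ≤ z ∧ z ≤ b * d := by
  obtain ⟨x, ⟨h1, h2⟩, y, ⟨h3, h4⟩, rfl⟩ := h
  exact ⟨mul_le_mul h1 h3 hc.le (ha.le.trans h1),
    mul_le_mul h2 h4 (hc.le.trans h3) (ha.le.trans (h1.trans h2))⟩

lemma Pset_comm (E F : Set ℝ) : Pset E F = Pset F E :=
  Set.image2_comm fun _ _ => mul_comm _ _

lemma Pset_mono {E E' F F' : Set ℝ} (h : E ⊆ E') (h' : F ⊆ F') : Pset E F ⊆ Pset E' F' :=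
  Set.image2_subset h h'

/-- The Cantor interval of level `p` with left endpoint `a`. -/
noncomputable def interval (x : ℕ × ℝ) : Set ℝ := Icc x.2 (x.2 + len x.1)

lemma interval_subset_stage {p : ℕ} {a : ℝ} (ha : a ∈ nodes p) : interval (p, a) ⊆ stage p :=
  fun _ hx => mem_stage.2 ⟨a, ha, hx.1, hx.2⟩

lemma exists_child_pair_of_lt {p : ℕ} {a b z : ℝ} (ha : a ∈ nodes p) (hb : b ∈ nodes p)
    (hab : a < b) (hz : z ∈ Pset (interval (p, a)) (interval (p, b))) :
    ∃ a' ∈ nodes (p + 1), ∃ b' ∈ nodes (p + 1), a' ≠ b' ∧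
      z ∈ Pset (interval (p + 1, a')) (interval (p + 1, b')) := by
  have hsep := nodes_separated ha hb hab
  obtain ⟨ha1, -⟩ := nodes_bounds p a ha
  obtain ⟨hb1, hb2⟩ := nodes_bounds p b hb
  have ht := len_pos (p + 1)
  obtain ⟨h1, h2⟩ := Pset_Icc_bounds (by linarith) (by linarith) hz
  dsimp only at h1 h2
  rw [len_succ p] at h2 hsep hb2
  have hal := left_mem_nodes ha
  have har := right_mem_nodes ha
  have hbl := left_mem_nodes hb
  have hbr := right_mem_nodes hb
  have key : ∀ a' ∈ nodes (p + 1), ∀ b' ∈ nodes (p + 1), a ≤ a' → b ≤ b' → a' < b' →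
      a' * b' ≤ z → z ≤ (a' + len (p + 1)) * (b' + len (p + 1)) →
      ∃ a' ∈ nodes (p + 1), ∃ b' ∈ nodes (p + 1), a' ≠ b' ∧
        z ∈ Pset (interval (p + 1, a')) (interval (p + 1, b')) := by
    intro a' ha' b' hb' haa hbb hlt h3 h4
    exact ⟨a', ha', b', hb', hlt.ne, mul_mem_Pset_Icc (by linarith) (by simpa using ht.le)
      (by linarith) (by simpa using ht.le) h3 h4⟩
  by_cases c1 : z ≤ (a + len (p + 1)) * (b + len (p + 1))
  · exact key a hal b hbl le_rfl le_rfl hab h1 c1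
  by_cases c2 : z ≤ (a + len (p + 1)) * (b + 2 * len (p + 1) + len (p + 1))
  · exact key a hal _ hbr le_rfl (by linarith) (by linarith) (by nlinarith) c2
  by_cases c3 : z ≤ (a + 2 * len (p + 1) + len (p + 1)) * (b + len (p + 1))
  · exact key _ har b hbl (by linarith) le_rfl (by linarith) (by nlinarith) c3
  · exact key _ har _ hbr (by linarith) (by linarith) (by linarith) (by nlinarith) (by linarith)

lemma exists_child_pair {p : ℕ} {a b z : ℝ} (ha : a ∈ nodes p) (hb : b ∈ nodes p)
    (hab : a ≠ b) (hz : z ∈ Pset (interval (p, a)) (interval (p, b))) :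
    ∃ a' ∈ nodes (p + 1), ∃ b' ∈ nodes (p + 1), a' ≠ b' ∧
      z ∈ Pset (interval (p + 1, a')) (interval (p + 1, b')) := by
  rcases hab.lt_or_gt with h | h
  · exact exists_child_pair_of_lt ha hb h hz
  · rw [Pset_comm] at hz
    obtain ⟨a', ha', b', hb', hne, h⟩ := exists_child_pair_of_lt hb ha h hz
    exact ⟨b', hb', a', ha', hne.symm, by rwa [Pset_comm]⟩

lemma mem_Pset_stage {p : ℕ} {a b z : ℝ} (ha : a ∈ nodes p) (hb : b ∈ nodes p)
    (hab : a ≠ b) (hz : z ∈ Pset (interval (p, a)) (interval (p, b))) (k : ℕ) :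
    z ∈ Pset (stage (p + k)) (stage (p + k)) := by
  suffices h : ∃ a' ∈ nodes (p + k), ∃ b' ∈ nodes (p + k), a' ≠ b' ∧
      z ∈ Pset (interval (p + k, a')) (interval (p + k, b')) by
    obtain ⟨a', ha', b', hb', -, h⟩ := h
    exact Pset_mono (interval_subset_stage ha') (interval_subset_stage hb') h
  induction k with
  | zero => exact ⟨a, ha, b, hb, hab, hz⟩
  | succ k ih =>
    obtain ⟨a', ha', b', hb', hne, h⟩ := ih
    exact exists_child_pair ha' hb' hne h

/-- Products of two distinct Cantor intervals of the same level lose nothing when restricted to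
the Cantor set. -/
lemma Pset_interval_subset {p : ℕ} {a b : ℝ} (ha : a ∈ nodes p) (hb : b ∈ nodes p)
    (hab : a ≠ b) : Pset (interval (p, a)) (interval (p, b)) ⊆ Pset core core := by
  intro z hz
  let T : ℕ → Set (ℝ × ℝ) := fun k => stage (p + k) ×ˢ stage (p + k) ∩ {q | q.1 * q.2 = z}
  have hclosed : IsClosed {q : ℝ × ℝ | q.1 * q.2 = z} :=
    isClosed_eq (continuous_fst.mul continuous_snd) continuous_const
  have hcomp : ∀ k, IsCompact (T k) := fun k =>
    ((isCompact_stage _).prod (isCompact_stage _)).inter_right hclosed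
  obtain ⟨⟨x, y⟩, hxy⟩ := IsCompact.nonempty_iInter_of_sequence_nonempty_isCompact_isClosed T
    (fun k => inter_subset_inter_left _ (prod_mono (stage_antitone (by omega))
      (stage_antitone (by omega))))
    (fun k => by
      obtain ⟨x, hx, y, hy, h⟩ := mem_Pset_stage ha hb hab hz k
      exact ⟨(x, y), ⟨hx, hy⟩, h⟩)
    (hcomp 0) (fun k => (hcomp k).isClosed)
  rw [mem_iInter] at hxy
  exact ⟨x, mem_core_of_forall_add fun k => (hxy k).1.1, y,
    mem_core_of_forall_add fun k => (hxy k).1.2, (hxy 0).2⟩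

/-- The products of points of the Cantor interval `x` that are lost in the Cantor set. -/
noncomputable def loss (x : ℕ × ℝ) : Set ℝ := Pset (interval x) (interval x) \ Pset core core

lemma loss_subset {p : ℕ} {a : ℝ} (ha : a ∈ nodes p) :
    loss (p, a) ⊆ Ioo ((a + len (p + 1)) * (a + 3 * len (p + 1))) ((a + 2 * len (p + 1)) ^ 2) ∪
      (loss (p + 1, a) ∪ loss (p + 1, a + 2 * len (p + 1))) := by
  rintro z ⟨hz, hzR⟩
  obtain ⟨ha1, -⟩ := nodes_bounds p a ha
  have ht := len_pos (p + 1)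
  obtain ⟨h1, h2⟩ := Pset_Icc_bounds (by linarith) (by linarith) hz
  dsimp only at h1 h2
  rw [len_succ p] at h2
  by_cases c1 : z ≤ (a + len (p + 1)) ^ 2
  · exact Or.inr (Or.inl ⟨mul_mem_Pset_Icc (by linarith) (by linarith) (by linarith)
      (by linarith) h1 (by simpa [sq] using c1), hzR⟩)
  by_cases c2 : z ≤ (a + len (p + 1)) * (a + 3 * len (p + 1))
  · refine absurd (Pset_interval_subset (left_mem_nodes ha) (right_mem_nodes ha) (by linarith)
      (mul_mem_Pset_Icc (by linarith) (by linarith) (by linarith)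
      (by linarith) (z := z) ?_ ?_)) hzR
    · dsimp only; nlinarith
    · dsimp only; linarith
  by_cases c3 : z < (a + 2 * len (p + 1)) ^ 2
  · exact Or.inl ⟨not_le.1 c2, c3⟩
  · refine Or.inr (Or.inr ⟨mul_mem_Pset_Icc (by linarith) (by linarith) (by linarith)
      (by linarith) ?_ ?_, hzR⟩)
    · dsimp only; linarith
    · dsimp only; linarith

lemma volume_loss_le_aux (m : ℕ) : ∀ (p : ℕ) (a : ℝ), a ∈ nodes p →
    volume (loss (p, a)) ≤ ENNReal.ofReal (len p ^ 2 / 7 + 2 * (2 / 3) ^ m * len p) := by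
  induction m with
  | zero =>
    intro p a ha
    obtain ⟨ha1, ha2⟩ := nodes_bounds p a ha
    have ht := len_pos p
    calc volume (loss (p, a)) ≤ volume (Icc (a * a) ((a + len p) * (a + len p))) :=
          measure_mono fun z hz => Pset_Icc_bounds (by linarith) (by linarith) hz.1
      _ ≤ _ := by
          rw [Real.volume_Icc]
          apply ENNReal.ofReal_le_ofReal
          nlinarith
  | succ m ih =>
    intro p a ha
    have ht := len_pos (p + 1)
    refine (measure_mono (loss_subset ha)).trans ((measure_union_le _ _).trans
      ((add_le_add_right ((measure_union_le _ _).trans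
        (add_le_add (ih _ _ (left_mem_nodes ha)) (ih _ _ (right_mem_nodes ha)))) _).trans ?_))
    have hm : (0 : ℝ) ≤ (2 / 3) ^ m := by positivity
    rw [Real.volume_Ioo, ← ENNReal.ofReal_add (by positivity) (by positivity),
      ← ENNReal.ofReal_add (by nlinarith) (by positivity)]
    apply ENNReal.ofReal_le_ofReal
    rw [len_succ p, pow_succ (2 / 3 : ℝ) m]
    linarith

lemma volume_loss_le {p : ℕ} {a : ℝ} (ha : a ∈ nodes p) :
    volume (loss (p, a)) ≤ ENNReal.ofReal (len p ^ 2 / 7) := by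
  have h : Filter.Tendsto (fun m : ℕ => len p ^ 2 / 7 + 2 * (2 / 3) ^ m * len p) Filter.atTop
      (nhds (len p ^ 2 / 7 + 2 * 0 * len p)) :=
    (((tendsto_pow_atTop_nhds_zero_of_lt_one (r := (2 / 3 : ℝ)) (by norm_num)
      (by norm_num)).const_mul 2).mul_const _).const_add _
  rw [mul_zero, zero_mul, add_zero] at h
  exact ge_of_tendsto' (ENNReal.tendsto_ofReal h) fun m => volume_loss_le_aux m p a ha

/-- The Cantor intervals in the left half of `x` that remain after one step of the subdivision. -/
noncomputable def leftChild (x : ℕ × ℝ) (k : ℕ) : ℕ × ℝ :=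
  (x.1 + (k + 1) + 1, x.2 + 2 * len (x.1 + (k + 1) + 1))

/-- The mirror image of `leftChild x k` in the Cantor interval `x`. -/
noncomputable def rightChild (x : ℕ × ℝ) (k : ℕ) : ℕ × ℝ :=
  (x.1 + (k + 1) + 1, x.2 + len x.1 - len (x.1 + (k + 1)))

/-- The Cantor intervals left in `x` after `n` steps of the fast subdivision. -/
def descendants : ℕ → ℕ × ℝ → Set (ℕ × ℝ)
  | 0, x => {x}
  | n + 1, x => ⋃ k, descendants n (leftChild x k) ∪ descendants n (rightChild x k)

/-- The pairs (level, left endpoint) of Cantor intervals. -/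
def Valid (x : ℕ × ℝ) : Prop := x.2 ∈ nodes x.1

lemma Valid.leftChild {x : ℕ × ℝ} (h : Valid x) (k : ℕ) : Valid (leftChild x k) :=
  right_mem_nodes (left_mem_nodes_add h (k + 1))

lemma Valid.rightChild {x : ℕ × ℝ} (h : Valid x) (k : ℕ) : Valid (rightChild x k) :=
  left_mem_nodes (right_mem_nodes_add h (k + 1))

lemma mem_descendants_succ {n : ℕ} {x z : ℕ × ℝ} : z ∈ descendants (n + 1) x ↔
    ∃ y ∈ descendants n x, ∃ k, z = leftChild y k ∨ z = rightChild y k := by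
  induction n generalizing x with
  | zero => simp [descendants, or_comm]
  | succ n ih =>
    rw [descendants]
    simp only [mem_iUnion, mem_union, ih]
    constructor
    · rintro ⟨k, ⟨y, hy, h⟩ | ⟨y, hy, h⟩⟩
      · exact ⟨y, mem_iUnion.2 ⟨k, Or.inl hy⟩, h⟩
      · exact ⟨y, mem_iUnion.2 ⟨k, Or.inr hy⟩, h⟩
    · rintro ⟨y, hy, h⟩
      obtain ⟨k, hy | hy⟩ := mem_iUnion.1 hy
      · exact ⟨k, Or.inl ⟨y, hy, h⟩⟩
      · exact ⟨k, Or.inr ⟨y, hy, h⟩⟩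

lemma Valid.of_mem_descendants {n : ℕ} {x y : ℕ × ℝ} (h : Valid x) (hy : y ∈ descendants n x) :
    Valid y := by
  induction n generalizing y with
  | zero => exact (mem_singleton_iff.1 hy) ▸ h
  | succ n ih =>
    obtain ⟨z, hz, k, rfl | rfl⟩ := mem_descendants_succ.1 hy
    · exact (ih hz).leftChild k
    · exact (ih hz).rightChild k

lemma volume_iUnion_loss_le (n : ℕ) {x : ℕ × ℝ} (hx : Valid x) :
    volume (⋃ y ∈ descendants n x, loss y) ≤
      ENNReal.ofReal (len x.1 ^ 2 / 7 * (1 / 36) ^ n) := by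
  induction n generalizing x with
  | zero => simpa [descendants] using volume_loss_le hx
  | succ n ih =>
    have hsub : (⋃ y ∈ descendants (n + 1) x, loss y) = ⋃ k,
        ((⋃ y ∈ descendants n (leftChild x k), loss y) ∪
          ⋃ y ∈ descendants n (rightChild x k), loss y) := by
      simp only [descendants, biUnion_iUnion, biUnion_union]
    have hsum : HasSum (fun k : ℕ => len x.1 ^ 2 / 7 * (1 / 36) ^ n * (2 / 81) * (1 / 9 : ℝ) ^ k)
        (len x.1 ^ 2 / 7 * (1 / 36) ^ (n + 1)) := by
      have h := (hasSum_geometric_of_lt_one (r := (1 / 9 : ℝ)) (by norm_num)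
        (by norm_num)).mul_left (len x.1 ^ 2 / 7 * (1 / 36) ^ n * (2 / 81))
      rwa [show len x.1 ^ 2 / 7 * (1 / 36) ^ n * (2 / 81) * (1 - 1 / 9 : ℝ)⁻¹ =
        len x.1 ^ 2 / 7 * (1 / 36) ^ (n + 1) by rw [pow_succ]; ring] at h
    rw [hsub, ← hsum.tsum_eq, ENNReal.ofReal_tsum_of_nonneg (fun k => by positivity)
      hsum.summable]
    refine (measure_iUnion_le _).trans (ENNReal.tsum_le_tsum fun k => ?_)
    refine (measure_union_le _ _).trans ((add_le_add (ih (hx.leftChild k))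
      (ih (hx.rightChild k))).trans ?_)
    rw [← ENNReal.ofReal_add (by positivity) (by positivity)]
    apply ENNReal.ofReal_le_ofReal
    have hl : len (x.1 + (k + 1) + 1) ^ 2 = len x.1 ^ 2 * (1 / 81) * (1 / 9) ^ k := by
      rw [add_assoc, len_add, div_pow, ← pow_mul, mul_comm _ 2, pow_mul, one_div_pow]
      norm_num [pow_succ]
      field_simp
      norm_num
    simp only [leftChild, rightChild, hl]
    linarith

lemma leftChild_subset {x : ℕ × ℝ} (k : ℕ) : interval (leftChild x k) ⊆
    Icc (x.2 + 2 * len (x.1 + (k + 1) + 1)) (x.2 + len (x.1 + (k + 1))) := by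
  rintro z ⟨h1, h2⟩
  simp only [leftChild] at h1 h2
  rw [len_succ (x.1 + (k + 1))]
  constructor <;> linarith

lemma rightChild_subset {x : ℕ × ℝ} (k : ℕ) : interval (rightChild x k) ⊆
    Icc (x.2 + len x.1 - len (x.1 + (k + 1)))
      (x.2 + len x.1 - 2 * len (x.1 + (k + 1) + 1)) := by
  rintro z ⟨h1, h2⟩
  simp only [rightChild] at h1 h2
  rw [len_succ (x.1 + (k + 1))] at *
  constructor <;> linarith

lemma len_antitone : Antitone len :=
  antitone_nat_of_succ_le fun p => by linarith [len_pos (p + 1), len_succ p]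

lemma three_len_le {p q : ℕ} (h : p < q) : 3 * len q ≤ len p := by
  rw [len_succ p]
  linarith [len_antitone (Nat.succ_le_of_lt h)]

lemma leftChild_subset_interval {x : ℕ × ℝ} (k : ℕ) : interval (leftChild x k) ⊆ interval x := by
  refine (leftChild_subset k).trans (Icc_subset_Icc ?_ ?_)
  · linarith [len_pos (x.1 + (k + 1) + 1)]
  · linarith [len_antitone (Nat.le_add_right x.1 (k + 1))]

lemma rightChild_subset_interval {x : ℕ × ℝ} (k : ℕ) :
    interval (rightChild x k) ⊆ interval x := by
  refine (rightChild_subset k).trans (Icc_subset_Icc ?_ ?_)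
  · linarith [len_antitone (Nat.le_add_right x.1 (k + 1))]
  · linarith [len_pos (x.1 + (k + 1) + 1)]

lemma leftChild_inter {x : ℕ × ℝ} {j k : ℕ} {z : ℝ} (hj : z ∈ interval (leftChild x j))
    (hk : z ∈ interval (leftChild x k)) : j ≤ k := by
  by_contra! h
  have h1 := (leftChild_subset j hj).2
  have h2 := (leftChild_subset k hk).1
  have h3 := three_len_le (show x.1 + (k + 1) < x.1 + (j + 1) by omega)
  have h4 := len_antitone (show x.1 + (k + 1) + 1 ≤ x.1 + (j + 1) by omega)
  linarith [len_pos (x.1 + (k + 1) + 1)]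

lemma rightChild_inter {x : ℕ × ℝ} {j k : ℕ} {z : ℝ} (hj : z ∈ interval (rightChild x j))
    (hk : z ∈ interval (rightChild x k)) : j ≤ k := by
  by_contra! h
  have h1 := (rightChild_subset j hj).1
  have h2 := (rightChild_subset k hk).2
  have h4 := len_antitone (show x.1 + (k + 1) + 1 ≤ x.1 + (j + 1) by omega)
  linarith [len_pos (x.1 + (k + 1) + 1)]

lemma leftChild_le {x : ℕ × ℝ} {k : ℕ} {z : ℝ} (h : z ∈ interval (leftChild x k)) :
    z ≤ x.2 + len x.1 / 3 := by
  linarith [(leftChild_subset k h).2, three_len_le (show x.1 < x.1 + (k + 1) by omega)]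

lemma le_rightChild {x : ℕ × ℝ} {k : ℕ} {z : ℝ} (h : z ∈ interval (rightChild x k)) :
    x.2 + 2 * (len x.1 / 3) ≤ z := by
  linarith [(rightChild_subset k h).1, three_len_le (show x.1 < x.1 + (k + 1) by omega)]

/-- The intervals left after `n` steps are pairwise disjoint. -/
lemma descendants_disjoint {n : ℕ} {r x y : ℕ × ℝ} {z : ℝ} (hx : x ∈ descendants n r)
    (hy : y ∈ descendants n r) (hzx : z ∈ interval x) (hzy : z ∈ interval y) : x = y := by
  induction n generalizing x y with
  | zero => exact hx.trans hy.symm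
  | succ n ih =>
    obtain ⟨u, hu, j, hxj⟩ := mem_descendants_succ.1 hx
    obtain ⟨v, hv, k, hyk⟩ := mem_descendants_succ.1 hy
    have huv : u = v := by
      refine ih hu hv ?_ ?_
      · rcases hxj with rfl | rfl
        · exact leftChild_subset_interval _ hzx
        · exact rightChild_subset_interval _ hzx
      · rcases hyk with rfl | rfl
        · exact leftChild_subset_interval _ hzy
        · exact rightChild_subset_interval _ hzy
    subst huv
    have hl := len_pos u.1
    rcases hxj with rfl | rfl <;> rcases hyk with rfl | rfl
    · rw [(leftChild_inter hzx hzy).antisymm (leftChild_inter hzy hzx)]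
    · linarith [leftChild_le hzx, le_rightChild hzy]
    · linarith [leftChild_le hzy, le_rightChild hzx]
    · rw [(rightChild_inter hzx hzy).antisymm (rightChild_inter hzy hzx)]

/-- The gaps removed from the Cantor interval `x` in one step of the fast subdivision. -/
def gaps (x : ℕ × ℝ) : Set ℝ := affI (interval x) '' gapB

lemma affI_interval (x : ℕ × ℝ) (t : ℝ) : affI (interval x) t = x.2 + len x.1 * t := by
  have h : x.2 ≤ x.2 + len x.1 := by linarith [len_pos x.1]
  rw [affI, interval, csInf_Icc h, csSup_Icc h]
  ring

lemma mem_gaps {x : ℕ × ℝ} {z : ℝ} : z ∈ gaps x ↔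
    (∃ k, z - x.2 ∈ Ioo (len (x.1 + (k + 1) + 1)) (2 * len (x.1 + (k + 1) + 1))) ∨
    z - x.2 ∈ Ioo (len (x.1 + 1)) (2 * len (x.1 + 1)) ∨
    ∃ k, x.2 + len x.1 - z ∈ Ioo (len (x.1 + (k + 1) + 1)) (2 * len (x.1 + (k + 1) + 1)) := by
  have hl := len_pos x.1
  have hk : ∀ k, len (x.1 + (k + 1) + 1) = len x.1 * (1 / 3 ^ (k + 2)) := by
    intro k
    rw [show x.1 + (k + 1) + 1 = x.1 + (k + 2) by omega, len_add]
    ring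
  have h1 : len (x.1 + 1) = len x.1 * (1 / 3) := by linarith [len_succ x.1]
  have h3 : ∀ k : ℕ, (3 : ℝ) ^ (k + 2) ≠ 0 := fun k => by positivity
  have hz : z ∈ gaps x ↔ (z - x.2) / len x.1 ∈ gapB := by
    constructor
    · rintro ⟨t, ht, rfl⟩
      rw [affI_interval]
      convert ht using 1
      field_simp
      ring
    · intro h
      refine ⟨_, h, ?_⟩
      rw [affI_interval, mul_div_cancel₀ _ hl.ne']
      ring
  obtain ⟨t, ht⟩ : ∃ t, z - x.2 = len x.1 * t := ⟨(z - x.2) / len x.1, by field_simp⟩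
  have hz' : x.2 + len x.1 - z = len x.1 * (1 - t) := by linarith
  have key : ∀ c s : ℝ, len x.1 * s ∈ Ioo (len x.1 * c) (2 * (len x.1 * c)) ↔
      s ∈ Ioo c (2 * c) := by
    intro c s
    rw [mem_Ioo, mem_Ioo, mul_lt_mul_iff_right₀ hl, mul_left_comm, mul_lt_mul_iff_right₀ hl]
  rw [hz, hz', ht, mul_div_cancel_left₀ _ hl.ne']
  simp only [hk, h1, key, gapB, mem_union, mem_iUnion, or_assoc]
  refine or_congr (exists_congr fun k => ?_) (or_congr ?_ (exists_congr fun k => ?_))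
  · rw [show 2 * (1 / (3 : ℝ) ^ (k + 2)) = 2 / 3 ^ (k + 2) by ring]
  · norm_num
  · rw [sub_div, sub_div, div_self (h3 k), mem_Ioo, mem_Ioo,
      show 2 * (1 / (3 : ℝ) ^ (k + 2)) = 2 / 3 ^ (k + 2) by ring]
    constructor <;> rintro ⟨_, _⟩ <;> constructor <;> linarith

lemma gaps_subset_interval (x : ℕ × ℝ) : gaps x ⊆ interval x := by
  intro z hz
  have hp := len_pos (x.1 + 1)
  have h1 := len_succ x.1
  have hk : ∀ k, 0 < len (x.1 + (k + 1) + 1) ∧ 3 * len (x.1 + (k + 1) + 1) ≤ len x.1 :=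
    fun k => ⟨len_pos _, three_len_le (by omega)⟩
  rcases mem_gaps.1 hz with ⟨k, h2, h3⟩ | ⟨h2, h3⟩ | ⟨k, h2, h3⟩
  · constructor <;> linarith [(hk k).1, (hk k).2]
  · constructor <;> linarith
  · constructor <;> linarith [(hk k).1, (hk k).2]

lemma core_disjoint_gaps {x : ℕ × ℝ} (hx : Valid x) {z : ℝ} (hz : z ∈ core) : z ∉ gaps x := by
  intro h
  rcases mem_gaps.1 h with ⟨k, h2, h3⟩ | ⟨h2, h3⟩ | ⟨k, h2, h3⟩
  · exact middle_third_notMem_stage (left_mem_nodes_add hx (k + 1)) (by linarith) (by linarith)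
      (mem_core.1 hz _)
  · exact middle_third_notMem_stage hx (by linarith) (by linarith) (mem_core.1 hz _)
  · have := len_succ (x.1 + (k + 1))
    exact middle_third_notMem_stage (right_mem_nodes_add hx (k + 1)) (by linarith) (by linarith)
      (mem_core.1 hz _)

lemma exists_scale {p : ℕ} {w : ℝ} (h0 : 0 < w) (h1 : w ≤ len (p + 1)) :
    ∃ k, len (p + (k + 1) + 1) < w ∧ w ≤ len (p + (k + 1)) := by
  have hex : ∃ k, len (p + (k + 1) + 1) < w := by
    obtain ⟨N, hN⟩ := Filter.eventually_atTop.1 ((tendsto_order.1 tendsto_len).2 w h0)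
    exact ⟨N, hN _ (by omega)⟩
  classical
  refine ⟨Nat.find hex, Nat.find_spec hex, ?_⟩
  rcases hm : Nat.find hex with _ | m
  · exact h1
  · exact not_lt.1 (Nat.find_min hex (m := m) (by omega))

lemma mem_children_of_notMem_gaps {x : ℕ × ℝ} {z : ℝ} (hz : z ∈ interval x) (hg : z ∉ gaps x) :
    z = x.2 ∨ z = x.2 + len x.1 ∨ ∃ k, z ∈ interval (leftChild x k) ∨
      z ∈ interval (rightChild x k) := by
  rw [mem_gaps] at hg
  push Not at hg
  obtain ⟨g1, g2, g3⟩ := hg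
  have hl := len_succ x.1
  rcases eq_or_lt_of_le hz.1 with h | h
  · exact Or.inl h.symm
  rcases eq_or_lt_of_le hz.2 with h' | h'
  · exact Or.inr (Or.inl h')
  refine Or.inr (Or.inr ?_)
  rcases le_or_gt (z - x.2) (len (x.1 + 1)) with hm | hm
  · obtain ⟨k, h1, h2⟩ := exists_scale (by linarith) hm
    have h3 : 2 * len (x.1 + (k + 1) + 1) ≤ z - x.2 := by
      by_contra! hc
      exact g1 k ⟨h1, hc⟩
    have h4 := len_succ (x.1 + (k + 1))
    exact ⟨k, Or.inl ⟨by simp only [leftChild]; linarith, by simp only [leftChild]; linarith⟩⟩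
  · have hm' : 2 * len (x.1 + 1) ≤ z - x.2 := by
      by_contra! hc
      exact g2 ⟨hm, hc⟩
    obtain ⟨k, h1, h2⟩ := exists_scale (p := x.1) (w := x.2 + len x.1 - z) (by linarith)
      (by linarith)
    have h3 : 2 * len (x.1 + (k + 1) + 1) ≤ x.2 + len x.1 - z := by
      by_contra! hc
      exact g3 k ⟨h1, hc⟩
    have h4 := len_succ (x.1 + (k + 1))
    exact ⟨k, Or.inr ⟨by simp only [rightChild]; linarith, by simp only [rightChild]; linarith⟩⟩

lemma notMem_scale_gap {p j k : ℕ} {w : ℝ} (h1 : 2 * len (p + (j + 1) + 1) ≤ w)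
    (h2 : w ≤ len (p + (j + 1))) :
    w ∉ Ioo (len (p + (k + 1) + 1)) (2 * len (p + (k + 1) + 1)) := by
  rintro ⟨h3, h4⟩
  rcases le_or_gt j k with h | h
  · linarith [len_antitone (show p + (j + 1) + 1 ≤ p + (k + 1) + 1 by omega)]
  · linarith [len_antitone (show p + (k + 1) + 1 ≤ p + (j + 1) by omega)]

lemma leftChild_disjoint_gaps {x : ℕ × ℝ} {j : ℕ} {z : ℝ} (hz : z ∈ interval (leftChild x j)) :
    z ∉ gaps x := by
  have h := leftChild_le hz
  obtain ⟨h1, h2⟩ := leftChild_subset j hz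
  have hl := len_succ x.1
  rw [mem_gaps]
  rintro (⟨k, hk⟩ | hk | ⟨k, hk⟩)
  · exact notMem_scale_gap (by linarith) (by linarith) hk
  · linarith [hk.1]
  · linarith [hk.2, three_len_le (show x.1 + 1 < x.1 + (k + 1) + 1 by omega),
      len_pos (x.1 + 1)]

lemma rightChild_disjoint_gaps {x : ℕ × ℝ} {j : ℕ} {z : ℝ}
    (hz : z ∈ interval (rightChild x j)) : z ∉ gaps x := by
  have h := le_rightChild hz
  obtain ⟨h1, h2⟩ := rightChild_subset j hz
  have hl := len_succ x.1
  rw [mem_gaps]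
  rintro (⟨k, hk⟩ | hk | ⟨k, hk⟩)
  · linarith [hk.2, three_len_le (show x.1 + 1 < x.1 + (k + 1) + 1 by omega),
      len_pos (x.1 + 1)]
  · linarith [hk.2]
  · exact notMem_scale_gap (by linarith) (by linarith) hk

/-- The explicit form of the fast subdivision. -/
def fastStage (n : ℕ) (r : ℕ × ℝ) : Set ℝ := core ∪ ⋃ x ∈ descendants n r, interval x

lemma mem_fastStage {n : ℕ} {r : ℕ × ℝ} {z : ℝ} : z ∈ fastStage n r ↔
    z ∈ core ∨ ∃ x ∈ descendants n r, z ∈ interval x := by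
  simp only [fastStage, mem_union, mem_iUnion, exists_prop]

lemma mem_stage_of_mem_interval {x : ℕ × ℝ} (hx : Valid x) {p : ℕ} (h : p ≤ x.1) {z : ℝ}
    (hz : z ∈ interval x) : z ∈ stage p :=
  stage_antitone h (interval_subset_stage hx hz)

lemma interval_isolated {n : ℕ} {r x : ℕ × ℝ} (hr : Valid r) (hx : x ∈ descendants n r) {z : ℝ}
    (hz : z ∈ fastStage n r) (h1 : x.2 - len x.1 < z) (h2 : z < x.2 + 2 * len x.1) :
    z ∈ interval x := by
  have hxv : Valid x := hr.of_mem_descendants hx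
  have hstage : z ∈ stage x.1 → z ∈ interval x :=
    fun h => mem_interval_of_mem_stage hxv h h1 h2
  rcases mem_fastStage.1 hz with hc | ⟨y, hy, hzy⟩
  · exact hstage (mem_core.1 hc _)
  have hyv : Valid y := hr.of_mem_descendants hy
  rcases le_or_gt x.1 y.1 with h | h
  · exact hstage (mem_stage_of_mem_interval hyv h hzy)
  · obtain ⟨a, ha, h3, h4⟩ := exists_ancestor_of_le h.le hxv
    have h5 := len_pos x.1
    have h6 := three_len_le h
    have hay : a = y.2 := by
      refine nodes_eq_of_close ha hyv ?_ ?_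
      · linarith [hzy.2]
      · linarith [hzy.1]
    subst hay
    have : x = y := descendants_disjoint (z := x.2) hx hy ⟨le_rfl, by linarith⟩
      ⟨h3, by linarith⟩
    rwa [this]

lemma preconnected_subset_interval {n : ℕ} {r x : ℕ × ℝ} (hr : Valid r)
    (hx : x ∈ descendants n r) {K : Set ℝ} (hK : IsPreconnected K) (hKS : K ⊆ fastStage n r)
    {u : ℝ} (hu : u ∈ K) (hux : u ∈ interval x) : K ⊆ interval x := by
  intro y hy
  have hl := len_pos x.1
  have hux1 := hux.1
  have hux2 := hux.2
  by_contra hyx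
  have hyx' : ¬ (x.2 ≤ y ∧ y ≤ x.2 + len x.1) := hyx
  rcases lt_or_ge y x.2 with h | h
  · have hv : max y (x.2 - len x.1 / 2) ∈ K :=
      hK.ordConnected.out hy hu ⟨le_max_left _ _, max_le (by linarith) (by linarith)⟩
    have := interval_isolated hr hx (hKS hv) (lt_max_of_lt_right (by linarith))
      (max_lt (by linarith) (by linarith))
    have hlt : max y (x.2 - len x.1 / 2) < x.2 := max_lt h (by linarith)
    exact absurd this.1 (not_le.2 hlt)
  · have h' : x.2 + len x.1 < y := by
      by_contra! hc
      exact hyx' ⟨h, hc⟩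
    have hv : min y (x.2 + len x.1 + len x.1 / 2) ∈ K :=
      hK.ordConnected.out hu hy ⟨le_min (by linarith) (by linarith), min_le_left _ _⟩
    have := interval_isolated hr hx (hKS hv) (lt_min (by linarith) (by linarith))
      (min_lt_of_right_lt (by linarith))
    have hlt : x.2 + len x.1 < min y (x.2 + len x.1 + len x.1 / 2) := lt_min h' (by linarith)
    exact absurd this.2 (not_le.2 hlt)

lemma interior_eq_empty_of_subset_core {K : Set ℝ} (h : K ⊆ core) : interior K = ∅ := by
  by_contra hne
  obtain ⟨u, hu⟩ := nonempty_iff_ne_empty.2 hne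
  obtain ⟨ε, hε, hball⟩ := Metric.isOpen_iff.1 isOpen_interior u hu
  obtain ⟨p, hp⟩ := ((tendsto_order.1 tendsto_len).2 (ε / 2) (by linarith)).exists
  have hl := len_pos p
  have hmem : ∀ v, |v - u| < ε → v ∈ stage p := fun v hv =>
    mem_core.1 (h (interior_subset (hball (by rwa [Metric.mem_ball, Real.dist_eq])))) p
  obtain ⟨a, ha, h1, h2⟩ := mem_stage.1 (hmem u (by simpa using hε))
  have := (mem_interval_of_mem_stage ha (hmem (a + len p + len p / 2) (by
    rw [abs_lt]; constructor <;> linarith)) (by linarith) (by linarith)).2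
  linarith

lemma connectedComponentIn_fastStage {n : ℕ} {r x : ℕ × ℝ} (hr : Valid r)
    (hx : x ∈ descendants n r) {u : ℝ} (hu : u ∈ interval x) :
    connectedComponentIn (fastStage n r) u = interval x := by
  have hsub : interval x ⊆ fastStage n r := fun z hz => mem_fastStage.2 (Or.inr ⟨x, hx, hz⟩)
  exact (preconnected_subset_interval hr hx isPreconnected_connectedComponentIn
    (connectedComponentIn_subset _ _) (mem_connectedComponentIn (hsub hu)) hu).antisymm
    (isPreconnected_Icc.subset_connectedComponentIn hu hsub)

lemma compsE_fastStage {n : ℕ} {r : ℕ × ℝ} (hr : Valid r) :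
    compsE (fastStage n r) = interval '' descendants n r := by
  ext K
  constructor
  · rintro ⟨⟨u, hu, rfl⟩, hne⟩
    by_contra hK
    refine hne.ne_empty (interior_eq_empty_of_subset_core fun v hv => ?_)
    rcases mem_fastStage.1 (connectedComponentIn_subset _ _ hv) with h | ⟨x, hx, hvx⟩
    · exact h
    · refine absurd ⟨x, hx, ?_⟩ hK
      rw [connectedComponentIn_eq hv, connectedComponentIn_fastStage hr hx hvx]
  · rintro ⟨x, hx, rfl⟩
    have hl := len_pos x.1
    refine ⟨⟨x.2, mem_fastStage.2 (Or.inr ⟨x, hx, le_rfl, by linarith⟩),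
      (connectedComponentIn_fastStage hr hx ⟨le_rfl, by linarith⟩).symm⟩, ?_⟩
    rw [interval, interior_Icc]
    exact nonempty_Ioo.2 (by linarith)

lemma fastStage_succ {n : ℕ} {r : ℕ × ℝ} (hr : Valid r) :
    fastStage (n + 1) r = fastStage n r \ ⋃ x ∈ descendants n r, gaps x := by
  ext z
  simp only [mem_sdiff, mem_fastStage, mem_iUnion, exists_prop, not_exists, not_and]
  constructor
  · rintro (hc | ⟨y, hy, hzy⟩)
    · exact ⟨Or.inl hc, fun x hx => core_disjoint_gaps (hr.of_mem_descendants hx) hc⟩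
    · obtain ⟨x, hx, k, hk⟩ := mem_descendants_succ.1 hy
      have hzx : z ∈ interval x := by
        rcases hk with rfl | rfl
        · exact leftChild_subset_interval _ hzy
        · exact rightChild_subset_interval _ hzy
      refine ⟨Or.inr ⟨x, hx, hzx⟩, fun w hw hzw => ?_⟩
      obtain rfl := descendants_disjoint hx hw hzx (gaps_subset_interval _ hzw)
      rcases hk with rfl | rfl
      · exact leftChild_disjoint_gaps hzy hzw
      · exact rightChild_disjoint_gaps hzy hzw
  · rintro ⟨hc | ⟨x, hx, hzx⟩, hg⟩
    · exact Or.inl hc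
    · have hxv := hr.of_mem_descendants hx
      rcases mem_children_of_notMem_gaps hzx (hg x hx) with rfl | rfl | ⟨k, h | h⟩
      · exact Or.inl (left_mem_core hxv)
      · exact Or.inl (right_mem_core hxv)
      · exact Or.inr ⟨_, mem_descendants_succ.2 ⟨x, hx, k, Or.inl rfl⟩, h⟩
      · exact Or.inr ⟨_, mem_descendants_succ.2 ⟨x, hx, k, Or.inr rfl⟩, h⟩

lemma valid_root : Valid (0, 2 / 3) := mem_singleton _

lemma fastD_eq_fastStage (n : ℕ) : fastD n = fastStage n (0, 2 / 3) := by
  induction n with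
  | zero =>
    have hI : interval (0, 2 / 3) = Icc (2 / 3) 1 := by
      rw [interval, len_zero]
      norm_num
    have hc : core ⊆ Icc (2 / 3) 1 := cantorK_inter_eq_core ▸ inter_subset_right
    simp only [fastD, fastStage, descendants, biUnion_singleton, hI, union_eq_right.2 hc]
  | succ n ih =>
    rw [fastStage_succ valid_root, fastD, ih, compsE_fastStage valid_root, biUnion_image]
    rfl

lemma mul_mem_of_mem_stage {x : ℕ × ℝ} (hx : Valid x) {u v : ℝ} (hu : u ∈ interval x)
    (hv : v ∈ stage x.1) : u * v ∈ Pset core core ∪ loss x := by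
  by_cases hR : u * v ∈ Pset core core
  · exact Or.inl hR
  obtain ⟨b, hb, hvb⟩ := mem_stage.1 hv
  by_cases hab : x.2 = b
  · subst hab
    exact Or.inr ⟨mem_image2_of_mem hu hvb, hR⟩
  · exact Or.inl (Pset_interval_subset hx hb hab (mem_image2_of_mem hu hvb))

lemma Pset_fastStage_subset {n : ℕ} {r : ℕ × ℝ} (hr : Valid r) :
    Pset (fastStage n r) (fastStage n r) ⊆
      Pset core core ∪ ⋃ x ∈ descendants n r, loss x := by
  have key : ∀ x ∈ descendants n r, ∀ u ∈ interval x, ∀ v ∈ stage x.1,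
      u * v ∈ Pset core core ∪ ⋃ x ∈ descendants n r, loss x := fun x hx u hu v hv =>
    union_subset_union_right _ (subset_biUnion_of_mem (u := loss) hx)
      (mul_mem_of_mem_stage (hr.of_mem_descendants hx) hu hv)
  rintro z ⟨u, hu, v, hv, rfl⟩
  dsimp only
  rcases mem_fastStage.1 hu with hu | ⟨x, hx, hu⟩ <;>
    rcases mem_fastStage.1 hv with hv | ⟨y, hy, hv⟩
  · exact Or.inl (mem_image2_of_mem hu hv)
  · rw [mul_comm]
    exact key y hy v hv u (mem_core.1 hu _)
  · exact key x hx u hu v (mem_core.1 hv _)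
  · rcases le_total x.1 y.1 with h | h
    · exact key x hx u hu v (mem_stage_of_mem_interval (hr.of_mem_descendants hy) h hv)
    · rw [mul_comm]
      exact key y hy v hv u (mem_stage_of_mem_interval (hr.of_mem_descendants hx) h hu)

end CantorProduct

theorem stmt15 (R : Set ℝ) (hR : R = cantorK ∩ Icc (2/3) 1) (n : ℕ) :
    volume (Pset R R) ≤ volume (Pset (fastD n) (fastD n)) ∧
    volume (Pset (fastD n) (fastD n)) ≤
      volume (Pset R R) + ENNReal.ofReal ((1/63) * (1/36)^n) := by
  rw [CantorProduct.cantorK_inter_eq_core] at hR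
  subst hR
  rw [CantorProduct.fastD_eq_fastStage]
  refine ⟨measure_mono (CantorProduct.Pset_mono subset_union_left subset_union_left), ?_⟩
  refine (measure_mono (CantorProduct.Pset_fastStage_subset CantorProduct.valid_root)).trans
    ((measure_union_le _ _).trans (add_le_add le_rfl
      ((CantorProduct.volume_iUnion_loss_le n CantorProduct.valid_root).trans_eq ?_)))
  rw [CantorProduct.len_zero]
  norm_num
end

section
/- Let K be the middle-third Cantor set and P(x,y) = xy. Then |L(P(K × K)) − 91782451/113374080| ≤ 10^{-6}, where L is Lebesgue measure on ℝ. In particular 17/21 < L(P(K × K)) < 5/6. -/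
open Set MeasureTheory

theorem cantorK_eq_cantorSet : cantorK = cantorSet := by
  rw [cantorSet_eq_zero_two_ofDigits]
  ext x
  constructor
  · rintro ⟨α, hα, rfl⟩
    refine ⟨fun k => if α k = 0 then 0 else 2, fun k => ?_, ?_⟩
    · dsimp only
      split_ifs <;> decide
    · unfold Real.ofDigits Real.ofDigitsTerm
      congr 1
      ext k
      rcases hα k with h | h <;> simp [h, div_eq_mul_inv]
  · rintro ⟨a, ha, rfl⟩
    refine ⟨fun k => ((a k : ℕ) : ℝ), fun k => ?_, ?_⟩
    · have := ha k
      dsimp only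
      generalize a k = d at this ⊢
      revert this
      fin_cases d <;> simp
    · unfold Real.ofDigits Real.ofDigitsTerm
      congr 1

/-- The affine copy of the Cantor set spanning `[c, c + k]`. -/
def cantorPiece (c k : ℝ) : Set ℝ := (fun x => c + k * x) '' cantorSet

theorem cantorPiece_eq_union (c k : ℝ) :
    cantorPiece c k = cantorPiece c (k / 3) ∪ cantorPiece (c + 2 * k / 3) (k / 3) := by
  unfold cantorPiece
  conv_lhs => rw [cantorSet_eq_union_halves, image_union, image_image, image_image]
  congr 1 <;> refine image_congr fun x _ => by ring

theorem isCompact_cantorPiece (c k : ℝ) : IsCompact (cantorPiece c k) :=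
  isCompact_cantorSet.image (by fun_prop)

theorem cantorPiece_subset_Icc (c : ℝ) {k : ℝ} (hk : 0 ≤ k) :
    cantorPiece c k ⊆ Icc c (c + k) := by
  rintro _ ⟨x, hx, rfl⟩
  obtain ⟨h0, h1⟩ := cantorSet_subset_unitInterval hx
  constructor <;> dsimp only <;> nlinarith

theorem isCompact_Pset {E F : Set ℝ} (hE : IsCompact E) (hF : IsCompact F) :
    IsCompact (Pset E F) := by
  rw [Pset, ← image_prod]
  exact (hE.prod hF).image continuous_mul

theorem Pset_mono {E E' F F' : Set ℝ} (hE : E ⊆ E') (hF : F ⊆ F') : Pset E F ⊆ Pset E' F' :=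
  image2_subset hE hF

theorem Pset_cantorPiece_subset_Icc {a b h : ℝ} (ha : 0 ≤ a) (hb : 0 ≤ b) (hh : 0 ≤ h) :
    Pset (cantorPiece a h) (cantorPiece b h) ⊆ Icc (a * b) ((a + h) * (b + h)) := by
  rintro _ ⟨x, hx, y, hy, rfl⟩
  obtain ⟨hx0, hx1⟩ := cantorPiece_subset_Icc a hh hx
  obtain ⟨hy0, hy1⟩ := cantorPiece_subset_Icc b hh hy
  exact ⟨mul_le_mul hx0 hy0 hb (ha.trans hx0),
    mul_le_mul hx1 hy1 (hb.trans hy0) (by linarith)⟩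

theorem exists_mem_Pset_cantorPiece_near (n : ℕ) {a b h z : ℝ} (hh : 0 < h) (ha : 0 < a)
    (hab : a + h ≤ b) (hba : b + h ≤ 3 * a) (hb1 : b + h ≤ 1)
    (hz : z ∈ Icc (a * b) ((a + h) * (b + h))) :
    ∃ w ∈ Pset (cantorPiece a h) (cantorPiece b h), |z - w| ≤ 2 * h / 3 ^ n := by
  induction n generalizing a b h with
  | zero =>
    have hmem : a * b ∈ Pset (cantorPiece a h) (cantorPiece b h) :=
      mem_image2_of_mem ⟨0, zero_mem_cantorSet, by simp⟩ ⟨0, zero_mem_cantorSet, by simp⟩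
    refine ⟨_, hmem, ?_⟩
    rw [abs_of_nonneg (by linarith [hz.1])]
    have := hz.2
    simp only [pow_zero, div_one]
    nlinarith
  | succ n ih =>
    have step : ∀ a' b' : ℝ, (a' = a ∨ a' = a + 2 * h / 3) → (b' = b ∨ b' = b + 2 * h / 3) →
        z ∈ Icc (a' * b') ((a' + h / 3) * (b' + h / 3)) →
        ∃ w ∈ Pset (cantorPiece a h) (cantorPiece b h), |z - w| ≤ 2 * h / 3 ^ (n + 1) := by
      intro a' b' ha' hb' hz'
      obtain ⟨w, hw, hzw⟩ := ih (a := a') (b := b') (h := h / 3) (by positivity)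
        (by rcases ha' with rfl | rfl <;> linarith)
        (by rcases ha' with rfl | rfl <;> rcases hb' with rfl | rfl <;> linarith)
        (by rcases ha' with rfl | rfl <;> rcases hb' with rfl | rfl <;> linarith)
        (by rcases hb' with rfl | rfl <;> linarith) hz'
      refine ⟨w, Pset_mono ?_ ?_ hw, hzw.trans_eq (by rw [pow_succ]; field_simp)⟩
      · rw [cantorPiece_eq_union a h]
        rcases ha' with rfl | rfl
        exacts [subset_union_left, subset_union_right]
      · rw [cantorPiece_eq_union b h]
        rcases hb' with rfl | rfl
        exacts [subset_union_left, subset_union_right]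
    obtain ⟨hz0, hz1⟩ := hz
    rcases le_total z ((a + h / 3) * (b + h / 3)) with h1 | h1
    · exact step a b (.inl rfl) (.inl rfl) ⟨hz0, h1⟩
    rcases le_total z ((a + h / 3) * (b + 2 * h / 3 + h / 3)) with h2 | h2
    · exact step a (b + 2 * h / 3) (.inl rfl) (.inr rfl) ⟨by nlinarith, h2⟩
    rcases le_total z ((a + 2 * h / 3 + h / 3) * (b + h / 3)) with h3 | h3
    · exact step (a + 2 * h / 3) b (.inr rfl) (.inl rfl) ⟨by nlinarith, h3⟩
    · exact step (a + 2 * h / 3) (b + 2 * h / 3) (.inr rfl) (.inr rfl)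
        ⟨by nlinarith, hz1.trans_eq (by ring)⟩

theorem Pset_cantorPiece_eq_Icc {a b h : ℝ} (hh : 0 < h) (ha : 0 < a)
    (hab : a + h ≤ b) (hba : b + h ≤ 3 * a) (hb1 : b + h ≤ 1) :
    Pset (cantorPiece a h) (cantorPiece b h) = Icc (a * b) ((a + h) * (b + h)) := by
  refine (Pset_cantorPiece_subset_Icc ha.le (by linarith) hh.le).antisymm fun z hz => ?_
  have hcl := (isCompact_Pset (isCompact_cantorPiece a h) (isCompact_cantorPiece b h)).isClosed
  rw [← hcl.closure_eq, Metric.mem_closure_iff]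
  intro ε hε
  obtain ⟨n, hn⟩ := exists_pow_lt_of_lt_one (div_pos hε (by positivity : 0 < 2 * h))
    (by norm_num : (1 / 3 : ℝ) < 1)
  obtain ⟨w, hw, hzw⟩ := exists_mem_Pset_cantorPiece_near n hh ha hab hba hb1 hz
  refine ⟨w, hw, hzw.trans_lt ?_⟩
  rw [lt_div_iff₀ (by positivity)] at hn
  calc 2 * h / 3 ^ n = (1 / 3) ^ n * (2 * h) := by rw [one_div, inv_pow]; ring
    _ < ε := hn

/-- The products of two points of the same Cantor piece. -/
def diagProd (c k : ℝ) : Set ℝ := Pset (cantorPiece c k) (cantorPiece c k)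

theorem isCompact_diagProd (c k : ℝ) : IsCompact (diagProd c k) :=
  isCompact_Pset (isCompact_cantorPiece c k) (isCompact_cantorPiece c k)

theorem diagProd_subset_Icc {c k : ℝ} (hc : 0 ≤ c) (hk : 0 ≤ k) :
    diagProd c k ⊆ Icc (c ^ 2) ((c + k) ^ 2) := by
  simpa only [sq, diagProd] using Pset_cantorPiece_subset_Icc hc hc hk

theorem diagProd_eq_union {c k : ℝ} (hk : 0 < k) (hkc : k ≤ 2 * c) (hck : c + k ≤ 1) :
    diagProd c k = diagProd c (k / 3) ∪
      Icc ((c + k / 3) ^ 2 - k ^ 2 / 9) ((c + 2 * k / 3) ^ 2 - k ^ 2 / 9) ∪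
      diagProd (c + 2 * k / 3) (k / 3) := by
  have hF : Pset (cantorPiece c (k / 3)) (cantorPiece (c + 2 * k / 3) (k / 3)) =
      Icc ((c + k / 3) ^ 2 - k ^ 2 / 9) ((c + 2 * k / 3) ^ 2 - k ^ 2 / 9) := by
    rw [Pset_cantorPiece_eq_Icc] <;> first | linarith | (congr 1 <;> ring)
  have hcomm : Pset (cantorPiece (c + 2 * k / 3) (k / 3)) (cantorPiece c (k / 3)) =
      Pset (cantorPiece c (k / 3)) (cantorPiece (c + 2 * k / 3) (k / 3)) :=
    image2_comm mul_comm
  rw [← hF]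
  conv_lhs => rw [diagProd, cantorPiece_eq_union, Pset, image2_union_left, image2_union_right,
    image2_union_right]
  change _ ∪ _ ∪ (Pset _ _ ∪ _) = _
  rw [hcomm]
  unfold diagProd Pset
  ext z
  simp only [mem_union]
  tauto

/-- The measure of the part of `diagProd c k` below `t`. -/
noncomputable def truncVol (c k t : ℝ) : ℝ := volume.real (diagProd c k ∩ Iio t)

theorem truncVol_eq_add {c k : ℝ} (t : ℝ) (hk : 0 < k) (hkc : k ≤ 2 * c) (hck : c + k ≤ 1) :
    truncVol c k t = truncVol c (k / 3) (min t ((c + k / 3) ^ 2 - k ^ 2 / 9)) +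
      max 0 (min t ((c + 2 * k / 3) ^ 2 - k ^ 2 / 9) - ((c + k / 3) ^ 2 - k ^ 2 / 9)) +
      truncVol (c + 2 * k / 3) (k / 3) t := by
  set l := (c + k / 3) ^ 2 - k ^ 2 / 9 with hl
  set u := (c + 2 * k / 3) ^ 2 - k ^ 2 / 9 with hu
  have hlu : (c + k / 3) ^ 2 ≤ u := by rw [hu]; nlinarith
  have hleft : diagProd c (k / 3) ⊆ Iic ((c + k / 3) ^ 2) :=
    ((diagProd_subset_Icc (by linarith) (by linarith)).trans Icc_subset_Iic_self)
  have hright : diagProd (c + 2 * k / 3) (k / 3) ⊆ Ioi u := fun z hz => by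
    have := (diagProd_subset_Icc (by linarith) (by linarith) hz).1
    rw [mem_Ioi, hu]
    nlinarith
  have hdecomp : diagProd c k ∩ Iio t = diagProd c (k / 3) ∩ Iio (min t l) ∪
      Icc l u ∩ Iio t ∪ diagProd (c + 2 * k / 3) (k / 3) ∩ Iio t := by
    rw [diagProd_eq_union hk hkc hck]
    ext z
    simp only [mem_union, mem_inter_iff, mem_Iio, lt_min_iff, mem_Icc]
    constructor
    · rintro ⟨(hz | hz) | hz, hzt⟩
      · rcases lt_or_ge z l with h | h
        · exact .inl (.inl ⟨hz, hzt, h⟩)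
        · exact .inl (.inr ⟨⟨h, (hleft hz).trans hlu⟩, hzt⟩)
      · exact .inl (.inr ⟨hz, hzt⟩)
      · exact .inr ⟨hz, hzt⟩
    · tauto
  have hmeas := (isCompact_diagProd (c + 2 * k / 3) (k / 3)).measurableSet.inter
    (measurableSet_Iio (a := t))
  have hfin : ∀ c' k', volume (diagProd c' k' ∩ Iio t) ≠ ⊤ := fun c' k' =>
    ((measure_mono inter_subset_left).trans_lt (isCompact_diagProd c' k').measure_lt_top).ne
  have hfin' : volume (diagProd c (k / 3) ∩ Iio (min t l)) ≠ ⊤ :=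
    ((measure_mono inter_subset_left).trans_lt (isCompact_diagProd c _).measure_lt_top).ne
  have hfinI : volume (Icc l u ∩ Iio t) ≠ ⊤ :=
    ((measure_mono inter_subset_left).trans_lt isCompact_Icc.measure_lt_top).ne
  have hvolI : volume.real (Icc l u ∩ Iio t) = max 0 (min t u - l) := by
    have hae : (Icc l u ∩ Iio t : Set ℝ) =ᵐ[volume] (Icc l u ∩ Iic t : Set ℝ) :=
      (Filter.EventuallyEq.refl _ _).inter Iio_ae_eq_Iic
    have hcut : Icc l u ∩ Iic t = Icc l (min t u) := by
      ext z
      simp only [mem_inter_iff, mem_Icc, mem_Iic, le_min_iff]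
      tauto
    rw [measureReal_congr hae, hcut, Real.volume_real_Icc, max_comm]
  unfold truncVol
  rw [hdecomp, measureReal_union _ hmeas (measure_union_ne_top hfin' hfinI)
    (hfin _ _), measureReal_union _ (measurableSet_Icc.inter measurableSet_Iio) hfin' hfinI, hvolI]
  · rw [disjoint_left]
    rintro z ⟨-, hz⟩ ⟨⟨hz', -⟩, -⟩
    exact absurd ((mem_Iio.1 hz).trans_le (min_le_right _ _)) (not_lt.2 hz')
  · rw [disjoint_left]
    rintro z (⟨-, hz⟩ | ⟨⟨-, hz⟩, -⟩) ⟨hz', -⟩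
    · have := hright hz'
      have := (mem_Iio.1 hz).trans_le (min_le_right _ _)
      simp only [mem_Ioi] at *
      nlinarith
    · exact absurd (hright hz') (not_lt.2 hz)

theorem truncVol_nonneg (c k t : ℝ) : 0 ≤ truncVol c k t := measureReal_nonneg

theorem truncVol_le {c k : ℝ} (t : ℝ) (hc : 0 ≤ c) (hk : 0 ≤ k) :
    truncVol c k t ≤ max 0 (min t ((c + k) ^ 2) - c ^ 2) := by
  have hsub : diagProd c k ∩ Iio t ⊆ Icc (c ^ 2) (min t ((c + k) ^ 2)) := fun z hz =>
    have h := diagProd_subset_Icc hc hk hz.1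
    ⟨h.1, le_min (le_of_lt hz.2) h.2⟩
  refine (measureReal_mono hsub isCompact_Icc.measure_lt_top.ne).trans_eq ?_
  rw [Real.volume_real_Icc, max_comm]

theorem le_truncVol_add {c k : ℝ} (n : ℕ) (t : ℝ) (hk : 0 < k) (hkc : k ≤ 2 * c)
    (hck : c + k ≤ 1) :
    max 0 (min t ((c + k) ^ 2) - c ^ 2) ≤ truncVol c k t + k ^ 2 / 7 + 2 * k * (2 / 3) ^ n := by
  induction n generalizing c k t with
  | zero =>
    have h0 := truncVol_nonneg c k t
    have := min_le_right t ((c + k) ^ 2)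
    refine max_le (by positivity) ?_
    nlinarith
  | succ n ih =>
    have hl := ih (c := c) (k := k / 3) (min t ((c + k / 3) ^ 2 - k ^ 2 / 9))
      (by linarith) (by linarith) (by linarith)
    have hr := ih (c := c + 2 * k / 3) (k := k / 3) t
      (by linarith) (by linarith) (by linarith)
    rw [truncVol_eq_add t hk hkc hck, pow_succ (2 / 3 : ℝ)]
    have hc : 0 < c := by linarith
    have key : max 0 (min t ((c + k) ^ 2) - c ^ 2) ≤
        max 0 (min (min t ((c + k / 3) ^ 2 - k ^ 2 / 9)) ((c + k / 3) ^ 2) - c ^ 2) +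
        max 0 (min t ((c + 2 * k / 3) ^ 2 - k ^ 2 / 9) - ((c + k / 3) ^ 2 - k ^ 2 / 9)) +
        k ^ 2 / 9 +
        max 0 (min t ((c + 2 * k / 3 + k / 3) ^ 2) - (c + 2 * k / 3) ^ 2) := by
      have e : c + 2 * k / 3 + k / 3 = c + k := by ring
      rw [e]
      have h1 : c ^ 2 ≤ (c + k / 3) ^ 2 - k ^ 2 / 9 := by nlinarith
      have h2 : (c + k / 3) ^ 2 ≤ (c + 2 * k / 3) ^ 2 - k ^ 2 / 9 := by nlinarith
      have h3 : 0 ≤ k ^ 2 / 9 := by positivity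
      generalize (c + k / 3) ^ 2 = A at *
      generalize (c + 2 * k / 3) ^ 2 = B at *
      generalize (c + k) ^ 2 = C at *
      generalize c ^ 2 = D at *
      generalize k ^ 2 / 9 = E at *
      refine max_le (by positivity) ?_
      grind
    refine key.trans ?_
    linarith

/-- The upper bound for `truncVol` from `n` steps of subdivision. -/
def truncBound : ℕ → ℚ → ℚ → ℚ → ℚ
  | 0, c, k, t => max 0 (min t ((c + k) ^ 2) - c ^ 2)
  | n + 1, c, k, t => truncBound n c (k / 3) (min t ((c + k / 3) ^ 2 - k ^ 2 / 9)) +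
      max 0 (min t ((c + 2 * k / 3) ^ 2 - k ^ 2 / 9) - ((c + k / 3) ^ 2 - k ^ 2 / 9)) +
      truncBound n (c + 2 * k / 3) (k / 3) t

theorem truncVol_mem_Icc (n : ℕ) {c k : ℚ} (t : ℚ) (hk : 0 < k) (hkc : k ≤ 2 * c)
    (hck : c + k ≤ 1) :
    truncVol c k t ∈ Icc (truncBound n c k t - (2 / 9) ^ n * k ^ 2 / 7 : ℝ)
      (truncBound n c k t) := by
  induction n generalizing c k t with
  | zero =>
    have hk' : (0 : ℝ) < k := by exact_mod_cast hk
    have hkc' : (k : ℝ) ≤ 2 * c := by exact_mod_cast hkc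
    have hck' : (c + k : ℝ) ≤ 1 := by exact_mod_cast hck
    simp only [truncBound]
    push_cast
    refine ⟨?_, truncVol_le _ (by linarith) hk'.le⟩
    have hlim : Filter.Tendsto (fun n : ℕ =>
        truncVol c k t + (k : ℝ) ^ 2 / 7 + 2 * k * (2 / 3 : ℝ) ^ n) Filter.atTop
        (nhds (truncVol c k t + (k : ℝ) ^ 2 / 7 + 2 * k * 0)) :=
      ((tendsto_pow_atTop_nhds_zero_of_lt_one (by norm_num) (by norm_num)).const_mul _).const_add _
    have := ge_of_tendsto' hlim fun n => le_truncVol_add n (t : ℝ) hk' hkc' hck'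
    linarith
  | succ n ih =>
    have hl := ih (c := c) (k := k / 3) (min t ((c + k / 3) ^ 2 - k ^ 2 / 9))
      (by linarith) (by linarith) (by linarith)
    have hr := ih (c := c + 2 * k / 3) (k := k / 3) t
      (by linarith) (by linarith) (by linarith)
    have heq := truncVol_eq_add (c := c) (k := k) t (by exact_mod_cast hk)
      (by exact_mod_cast hkc) (by exact_mod_cast hck)
    simp only [truncBound]
    push_cast at hl hr ⊢
    rw [heq, pow_succ (2 / 9 : ℝ)]
    constructor <;> linarith [hl.1, hl.2, hr.1, hr.2]

theorem Pset_cantorSet_eq_union :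
    Pset cantorSet cantorSet =
      (fun x => 1 / 3 * x) '' Pset cantorSet cantorSet ∪ diagProd (2 / 3) (1 / 3) := by
  have hK : cantorSet = cantorPiece 0 1 := by simp [cantorPiece]
  have hU : cantorSet = (fun x => 1 / 3 * x) '' cantorSet ∪ cantorPiece (2 / 3) (1 / 3) := by
    conv_lhs => rw [hK, cantorPiece_eq_union]
    norm_num [cantorPiece]
  have hA : cantorPiece (2 / 3) (1 / 3) ⊆ cantorSet := by
    conv_rhs => rw [hU]
    exact subset_union_right
  have hL : ∀ x ∈ cantorSet, 1 / 3 * x ∈ cantorSet := fun x hx => by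
    rw [hU]
    exact .inl ⟨x, hx, rfl⟩
  ext z
  constructor
  · rintro ⟨x, hx, y, hy, rfl⟩
    have hx' := hx
    have hy' := hy
    rw [hU] at hx' hy'
    rcases hx' with ⟨x', hx', rfl⟩ | hx'
    · exact .inl ⟨x' * y, ⟨x', hx', y, hy, rfl⟩, by ring⟩
    rcases hy' with ⟨y', hy', rfl⟩ | hy'
    · exact .inl ⟨x * y', ⟨x, hx, y', hy', rfl⟩, by ring⟩
    · exact .inr ⟨x, hx', y, hy', rfl⟩
  · rintro (⟨_, ⟨x, hx, y, hy, rfl⟩, rfl⟩ | hz)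
    · exact ⟨1 / 3 * x, hL x hx, y, hy, by ring⟩
    · exact Pset_mono hA hA hz

theorem volume_real_Pset_cantorSet :
    volume.real (Pset cantorSet cantorSet) = 3 / 2 * volume.real (diagProd (2 / 3) (1 / 3)) := by
  have hC := isCompact_Pset isCompact_cantorSet isCompact_cantorSet
  have hD := isCompact_diagProd (2 / 3) (1 / 3)
  have hscale : volume.real ((fun x => 1 / 3 * x) '' Pset cantorSet cantorSet) =
      1 / 3 * volume.real (Pset cantorSet cantorSet) := by
    have := Measure.addHaar_image_homothety (volume : Measure ℝ) 0 (1 / 3)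
      (Pset cantorSet cantorSet)
    have himg : (AffineMap.homothety (0 : ℝ) (1 / 3 : ℝ) : ℝ → ℝ) = fun x => 1 / 3 * x := by
      ext x
      simp [AffineMap.homothety_apply]
    rw [himg] at this
    rw [Measure.real, this, ENNReal.toReal_mul, ENNReal.toReal_ofReal (by positivity)]
    norm_num [Measure.real]
  have hdisj : Disjoint ((fun x => 1 / 3 * x) '' Pset cantorSet cantorSet)
      (diagProd (2 / 3) (1 / 3)) := by
    rw [disjoint_left]
    rintro _ ⟨_, ⟨x, hx, y, hy, rfl⟩, rfl⟩ hz
    have hz' := (diagProd_subset_Icc (by norm_num) (by norm_num) hz).1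
    obtain ⟨hx0, hx1⟩ := cantorSet_subset_unitInterval hx
    obtain ⟨hy0, hy1⟩ := cantorSet_subset_unitInterval hy
    dsimp only at hz'
    nlinarith
  have hunion := measureReal_union (μ := volume) hdisj hD.measurableSet
    (hC.image (by fun_prop)).measure_lt_top.ne hD.measure_lt_top.ne
  rw [← Pset_cantorSet_eq_union, hscale] at hunion
  linarith

theorem stmt17 :
    |(volume (Pset cantorK cantorK)).toReal - 91782451/113374080| ≤ 1/10^6 ∧
    17/21 < (volume (Pset cantorK cantorK)).toReal ∧
    (volume (Pset cantorK cantorK)).toReal < 5/6 := by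
  have hvol : truncVol (2 / 3) (1 / 3) 2 = volume.real (diagProd (2 / 3) (1 / 3)) := by
    unfold truncVol
    rw [inter_eq_left.2]
    intro z hz
    have := (diagProd_subset_Icc (by norm_num) (by norm_num) hz).2
    rw [mem_Iio]
    linarith
  have hb := truncVol_mem_Icc 7 (c := 2 / 3) (k := 1 / 3) 2 (by norm_num) (by norm_num)
    (by norm_num)
  have hlo : 2 / 3 * (91782451 / 113374080 : ℚ) ≤ truncBound 7 (2 / 3) (1 / 3) 2 := by
    decide +kernel
  have hhi : truncBound 7 (2 / 3) (1 / 3) 2 ≤ 2 / 3 * (91782451 / 113374080 + 1 / 10 ^ 7 : ℚ) := by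
    decide +kernel
  have hlo' : (_ : ℝ) ≤ _ := Rat.cast_le.2 hlo
  have hhi' : (_ : ℝ) ≤ _ := Rat.cast_le.2 hhi
  push_cast at hb hlo' hhi'
  rw [hvol] at hb
  obtain ⟨h1, h2⟩ := hb
  rw [cantorK_eq_cantorSet, ← Measure.real, volume_real_Pset_cantorSet, abs_le]
  refine ⟨⟨?_, ?_⟩, ?_, ?_⟩ <;> norm_num at * <;> linarith
end
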